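/- Suppose the meromorphic mapping Φ = (φ₁,…,φ_n) admits an algebraic addition theorem, let θ be a primitive element as described, and for each k, p let P_{kp} ∈ ℂ[z₀, z₁,…,z_n] be a nonzero polynomial with P_{kp}(∂φ_k/∂u_p(u); φ₁(u),…,φ_n(u)) = 0 identically. Fix b ∈ ℂⁿ and k ∈ {1,…,n}. If u₁, u₂ ∈ ℂⁿ are points at which all φ_j, all first-order partial derivatives and θ are analytic, at which φ_k is analytic at u₁+b and u₂+b, such that φ_j(u₁) = φ_j(u₂) for all j and θ(u₁) = θ(u₂), and such that the denominators B_{jp}(θ(u₁); φ₁(u₁),…,φ_n(u₁)) and the partials ∂P_{jp}/∂z₀(∂φ_j/∂u_p(u₁); φ₁(u₁),…,φ_n(u₁)) are nonzero for all j, p, then φ_k(u₁ + b) = φ_k(u₂ + b). -/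

import Mathlib

open MvPolynomial

/-- The partial derivative `∂f/∂u_p` of a function on ℂⁿ. -/
noncomputable def pd {n : ℕ} (f : (Fin n → ℂ) → ℂ) (p : Fin n) (u : Fin n → ℂ) : ℂ :=
  fderiv ℂ f u (Pi.single p 1)

/-- `f` is meromorphic on ℂⁿ: a quotient of two everywhere-analytic functions. -/
def Mero {n : ℕ} (f : (Fin n → ℂ) → ℂ) : Prop :=
  ∃ g h : (Fin n → ℂ) → ℂ, (∀ u, AnalyticAt ℂ g u) ∧ (∀ u, AnalyticAt ℂ h u) ∧
    (∃ u, h u ≠ 0) ∧ ∀ u, h u ≠ 0 → f u = g u / h u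

/-- The Jacobian determinant of the family `φ` is not identically zero. -/
def AnalyticallyIndep {n : ℕ} (φ : Fin n → (Fin n → ℂ) → ℂ) : Prop :=
  ∃ u : Fin n → ℂ, (∀ j, AnalyticAt ℂ (φ j) u) ∧
    Matrix.det (Matrix.of fun k p => pd (φ k) p u) ≠ 0

/-- `Φ = (φ₁,…,φ_n)` admits an algebraic addition theorem: for each `k` there is a
polynomial `G_k` in the variables `λ` (= `none`), `x_j` (= `some (inl j)`) and
`y_j` (= `some (inr j)`), of degree ≥ 1 in `λ`, with
`G_k(φ_k(u+v); φ(u), φ(v)) = 0` wherever all functions involved are analytic. -/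
def AdmitsAAT {n : ℕ} (φ : Fin n → (Fin n → ℂ) → ℂ) : Prop :=
  ∀ k : Fin n, ∃ G : MvPolynomial (Option (Fin n ⊕ Fin n)) ℂ,
    1 ≤ G.degreeOf none ∧
    ∀ u v : Fin n → ℂ, (∀ j, AnalyticAt ℂ (φ j) u) → (∀ j, AnalyticAt ℂ (φ j) v) →
      AnalyticAt ℂ (φ k) (u + v) →
      eval (fun i => i.elim (φ k (u + v)) (Sum.elim (fun j => φ j u) fun j => φ j v)) G = 0

/-- The valuation sending the variable `none` to `θ(u)` and `some j` to `φ_j(u)`. -/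
noncomputable def tval {n : ℕ} (θ : (Fin n → ℂ) → ℂ) (φ : Fin n → (Fin n → ℂ) → ℂ)
    (u : Fin n → ℂ) : Option (Fin n) → ℂ :=
  fun i => i.elim (θ u) fun j => φ j u

/-- `f` is a rational function on ℂⁿ. -/
def RatFn {n : ℕ} (f : (Fin n → ℂ) → ℂ) : Prop :=
  ∃ P Q : MvPolynomial (Fin n) ℂ, Q ≠ 0 ∧
    ∃ s : Set (Fin n → ℂ), IsOpen s ∧ s.Nonempty ∧
      ∀ u ∈ s, f u = eval u P / eval u Q

open Filter Topology in
theorem aux_zero_of_dense {E : Type*} [TopologicalSpace E] {S : Set E} (hS : Dense S)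
    {F : E → ℂ} {x : E} (hF : ContinuousAt F x) (h : ∀ᶠ y in 𝓝 x, y ∈ S → F y = 0) :
    F x = 0 := by
  by_contra hne
  have h1 : ∀ᶠ y in 𝓝 x, F y ≠ 0 := hF.eventually_ne hne
  have h2 : ∃ᶠ y in 𝓝 x, y ∈ S := mem_closure_iff_frequently.1 (hS x)
  obtain ⟨y, hy, h3, h4⟩ := (h2.and_eventually (h1.and h)).exists
  exact h3 (h4 hy)

open Filter Topology in
theorem aux_dense_ne {n : ℕ} {h : (Fin n → ℂ) → ℂ} (ha : ∀ u, AnalyticAt ℂ h u)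
    (hne : ∃ u, h u ≠ 0) : Dense {u | h u ≠ 0} := by
  intro x
  rw [mem_closure_iff_frequently]
  intro hx
  obtain ⟨u, hu⟩ := hne
  apply hu
  have h1 : AnalyticOnNhd ℂ h Set.univ := fun u _ => ha u
  have h2 : AnalyticOnNhd ℂ (fun _ : Fin n → ℂ => (0 : ℂ)) Set.univ :=
    fun u _ => analyticAt_const
  have := AnalyticOnNhd.eq_of_eventuallyEq (z₀ := x) h1 h2 (by
    filter_upwards [hx] with y hy
    simpa using hy)
  rw [this]

open Filter Topology in
theorem aux_mero_ident {n : ℕ} {f : (Fin n → ℂ) → ℂ} (hf : Mero f) (u₁ u₂ b : Fin n → ℂ)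
    (h0 : ∀ᶠ w in 𝓝 (0 : Fin n → ℂ), f (u₁ + w) = f (u₂ + w))
    (h1b : AnalyticAt ℂ f (u₁ + b)) (h2b : AnalyticAt ℂ f (u₂ + b)) :
    f (u₁ + b) = f (u₂ + b) := by
  obtain ⟨g, h, hg, hh, hne, hfgh⟩ := hf
  have tr : ∀ (q : (Fin n → ℂ) → ℂ) (c : Fin n → ℂ), (∀ u, AnalyticAt ℂ q u) →
      ∀ u, AnalyticAt ℂ (fun w => q (c + w)) u := by
    intro q c hq u
    exact (hq (c + u)).comp' (f := fun w => c + w) (analyticAt_const.add analyticAt_id)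
  have hd : ∀ c : Fin n → ℂ, Dense {w | h (c + w) ≠ 0} := by
    intro c
    refine aux_dense_ne (tr h c hh) ?_
    obtain ⟨u, hu⟩ := hne
    exact ⟨u - c, by simpa using hu⟩
  have hcont : Continuous h := continuous_iff_continuousAt.2 fun u => (hh u).continuousAt
  have hS : Dense ({w | h (u₁ + w) ≠ 0} ∩ {w | h (u₂ + w) ≠ 0}) :=
    (hd u₁).inter_of_isOpen_left (hd u₂)
      (isOpen_ne_fun (hcont.comp (continuous_const.add continuous_id)) continuous_const)
  have hFa : ∀ w, AnalyticAt ℂ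
      (fun w => g (u₁ + w) * h (u₂ + w) - g (u₂ + w) * h (u₁ + w)) w := fun w =>
    ((tr g u₁ hg w).mul (tr h u₂ hh w)).sub ((tr g u₂ hg w).mul (tr h u₁ hh w))
  have hF0 : ∀ᶠ w in 𝓝 (0 : Fin n → ℂ),
      g (u₁ + w) * h (u₂ + w) - g (u₂ + w) * h (u₁ + w) = 0 := by
    filter_upwards [h0.eventually_nhds] with w hw
    refine aux_zero_of_dense (F := fun w => g (u₁ + w) * h (u₂ + w) - g (u₂ + w) * h (u₁ + w))
      hS (hFa w).continuousAt ?_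
    filter_upwards [hw] with y hy hyS
    obtain ⟨ha, hb⟩ := hyS
    simp only [Set.mem_setOf_eq] at ha hb
    rw [hfgh _ ha, hfgh _ hb, div_eq_div_iff ha hb] at hy
    simp [hy]
  have hall : ∀ w, g (u₁ + w) * h (u₂ + w) - g (u₂ + w) * h (u₁ + w) = 0 := by
    have := AnalyticOnNhd.eq_of_eventuallyEq (z₀ := (0 : Fin n → ℂ))
      (f := fun w => g (u₁ + w) * h (u₂ + w) - g (u₂ + w) * h (u₁ + w))
      (g := fun _ : Fin n → ℂ => (0 : ℂ)) (𝕜 := ℂ)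
      (fun u _ => hFa u) (fun u _ => analyticAt_const) hF0
    intro w
    exact congrFun this w
  have hc : ∀ c : Fin n → ℂ, AnalyticAt ℂ f (c + b) → ContinuousAt (fun w => f (c + w)) b := by
    intro c hcb
    exact ContinuousAt.comp' (f := fun w => c + w) hcb.continuousAt
      (continuous_const.add continuous_id).continuousAt
  refine sub_eq_zero.1 (aux_zero_of_dense (F := fun w => f (u₁ + w) - f (u₂ + w)) hS
    ((hc u₁ h1b).sub (hc u₂ h2b)) (Eventually.of_forall ?_))
  rintro y ⟨ha, hb⟩
  simp only [Set.mem_setOf_eq] at ha hb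
  rw [hfgh _ ha, hfgh _ hb, sub_eq_zero, div_eq_div_iff ha hb]
  exact sub_eq_zero.1 (hall y)

theorem aux_poly_deriv {σ : Type*} [Fintype σ] [DecidableEq σ] (P : MvPolynomial σ ℂ)
    (a : σ → ℂ) : ∃ L : (σ → ℂ) →L[ℂ] ℂ, HasStrictFDerivAt (fun x => eval x P) L a ∧
      ∀ i, L (Pi.single i 1) = eval a (pderiv i P) := by
  induction P using MvPolynomial.induction_on with
  | C c => exact ⟨0, by simpa using hasStrictFDerivAt_const c a, by simp⟩
  | add p q hp hq =>
    obtain ⟨L, hL, hL'⟩ := hp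
    obtain ⟨M, hM, hM'⟩ := hq
    refine ⟨L + M, ?_, fun i => by simp [hL', hM']⟩
    simpa using hL.fun_add hM
  | mul_X p j hp =>
    obtain ⟨L, hL, hL'⟩ := hp
    have hX : HasStrictFDerivAt (fun x : σ → ℂ => x j)
      (ContinuousLinearMap.proj (R := ℂ) (φ := fun _ : σ => ℂ) j) a :=
      (ContinuousLinearMap.proj (R := ℂ) (φ := fun _ : σ => ℂ) j).hasStrictFDerivAt
    refine ⟨_, by simpa using hL.fun_mul hX, fun i => ?_⟩
    by_cases hij : i = j
    · subst hij
      simp [hL', pderiv_mul, mul_comm, add_comm]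
    · simp [hL', pderiv_mul, pderiv_X, Pi.single_apply, mul_comm, hij, Ne.symm hij, eq_comm]

open Filter Topology in
theorem aux_poly_lip {n : ℕ} (P : MvPolynomial (Option (Fin n)) ℂ) (a : Option (Fin n) → ℂ)
    (ha : eval a (pderiv none P) ≠ 0) :
    ∃ C : ℝ, 0 ≤ C ∧ ∀ᶠ p in 𝓝 (a, a), eval p.1 P = 0 → eval p.2 P = 0 →
      ‖p.1 none - p.2 none‖ ≤ C * ‖(fun j : Fin n => p.1 (some j) - p.2 (some j))‖ := by
  obtain ⟨L, hL, hL'⟩ := aux_poly_deriv P a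
  set c := eval a (pderiv none P) with hc
  have hcpos : 0 < ‖c‖ := norm_pos_iff.2 ha
  refine ⟨(‖L‖ + ‖c‖ / 2) / (‖c‖ / 2), by positivity, ?_⟩
  have := hL.isLittleO.def (half_pos hcpos)
  filter_upwards [this] with p hp h1 h2
  rw [h1, h2] at hp
  set z := p.1 none - p.2 none with hz
  set x := (fun j : Fin n => p.1 (some j) - p.2 (some j)) with hx
  set X : Option (Fin n) → ℂ := fun i => i.elim 0 x with hX
  have hdec : p.1 - p.2 = z • (Pi.single none 1 : Option (Fin n) → ℂ) + X := by
    ext i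
    cases i <;> simp [hX, hz, hx]
  have hXn : ‖X‖ ≤ ‖x‖ := by
    rw [pi_norm_le_iff_of_nonneg (norm_nonneg _)]
    rintro (_ | j)
    · simp [hX]
    · exact norm_le_pi_norm x j
  have hdn : ‖p.1 - p.2‖ ≤ ‖z‖ + ‖x‖ := by
    rw [pi_norm_le_iff_of_nonneg (by positivity)]
    rintro (_ | j)
    · simpa [hz] using norm_nonneg x
    · exact (norm_le_pi_norm x j).trans (by simp)
  have hLd : L (p.1 - p.2) = z * c + L X := by
    rw [hdec, map_add, map_smul, hL', smul_eq_mul]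
  have h3 : ‖z * c + L X‖ ≤ ‖c‖ / 2 * (‖z‖ + ‖x‖) := by
    rw [← hLd]
    refine le_trans ?_ (hp.trans (by gcongr))
    rw [sub_zero, zero_sub, norm_neg]
  have h4 : ‖z‖ * ‖c‖ ≤ ‖c‖ / 2 * (‖z‖ + ‖x‖) + ‖L‖ * ‖x‖ := by
    have e : z * c = (z * c + L X) - L X := by ring
    rw [← norm_mul, e]
    refine (norm_sub_le _ _).trans (add_le_add h3 ?_)
    exact (L.le_opNorm X).trans (by gcongr)
  rw [div_mul_eq_mul_div, le_div_iff₀ (by positivity)]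
  nlinarith

open Filter Topology in
theorem aux_gronwall {n : ℕ} (D : (Fin n → ℂ) → (Fin n → ℂ))
    (D' : (Fin n → ℂ) → (Fin n → ℂ) →L[ℂ] (Fin n → ℂ)) (C : ℝ) (hC : 0 ≤ C)
    (hD : ∀ᶠ w in 𝓝 0, HasFDerivAt D (D' w) w) (hD0 : D 0 = 0)
    (hb : ∀ᶠ w in 𝓝 0, ∀ j p, ‖D' w (Pi.single p 1) j‖ ≤ C * ‖D w‖) :
    ∀ᶠ w in 𝓝 0, D w = 0 := by
  obtain ⟨r, hr, hball⟩ := Metric.eventually_nhds_iff_ball.1 (hD.and hb)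
  refine Metric.eventually_nhds_iff_ball.2 ⟨r, hr, fun w hw => ?_⟩
  have hmem : ∀ t ∈ Set.Icc (0 : ℝ) 1, t • w ∈ Metric.ball (0 : Fin n → ℂ) r := by
    intro t ht
    rw [mem_ball_zero_iff] at hw ⊢
    rw [norm_smul, Real.norm_of_nonneg ht.1]
    exact (mul_le_of_le_one_left (norm_nonneg _) ht.2).trans_lt hw
  have hder : ∀ t ∈ Set.Icc (0 : ℝ) 1,
      HasDerivAt (fun t : ℝ => D (t • w)) (D' (t • w) w) t := by
    intro t ht
    have h1 := ((hball _ (hmem t ht)).1).restrictScalars ℝ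
    have h2 : HasDerivAt (fun t : ℝ => t • w) w t := by
      simpa using (hasDerivAt_id t).smul_const w
    exact h1.comp_hasDerivAt t h2
  have key := eq_zero_of_abs_deriv_le_mul_abs_self_of_eq_zero_right
    (f := fun t : ℝ => D (t • w)) (f' := fun t => D' (t • w) w) (K := n * (‖w‖ * C))
    (a := 0) (b := 1)
    (fun t ht => (hder t ht).continuousAt.continuousWithinAt)
    (fun t ht => (hder t (Set.Ico_subset_Icc_self ht)).hasDerivWithinAt)
    (by simpa using hD0) ?_
  · simpa using key 1 (by simp)
  · intro t ht
    have hb' := (hball _ (hmem t (Set.Ico_subset_Icc_self ht))).2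
    rw [pi_norm_le_iff_of_nonneg (by positivity)]
    intro j
    have hw' : w = ∑ p, w p • (Pi.single p 1 : Fin n → ℂ) := by
      ext i
      simp [Finset.sum_apply, Pi.single_apply]
    have : D' (t • w) w j = ∑ p, w p * D' (t • w) (Pi.single p 1) j := by
      refine (congrArg (fun v => D' (t • w) v j) hw').trans ?_
      simp only [map_sum, Finset.sum_apply, map_smul, Pi.smul_apply, smul_eq_mul]
    rw [this]
    refine (norm_sum_le _ _).trans ?_
    refine (Finset.sum_le_card_nsmul _ _ (‖w‖ * (C * ‖D (t • w)‖)) ?_).trans ?_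
    · intro p _
      rw [norm_mul]
      exact mul_le_mul (norm_le_pi_norm w p) (hb' j p) (norm_nonneg _) (norm_nonneg _)
    · simp [mul_assoc]

open Filter Topology in
theorem aat_theta_determines_translate {n : ℕ} (hn : 1 ≤ n) (φ : Fin n → (Fin n → ℂ) → ℂ)
    (hmero : ∀ k, Mero (φ k)) (hindep : AnalyticallyIndep φ) (haat : AdmitsAAT φ)
    (θ : (Fin n → ℂ) → ℂ) (α : Fin n → Fin n → ℂ)
    (hθ : ∀ u, θ u = ∑ k : Fin n, ∑ p : Fin n, α k p * pd (φ k) p u)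
    (V : MvPolynomial (Option (Fin n)) ℂ) (hV0 : V ≠ 0)
    (hV : ∀ u, (∀ j, AnalyticAt ℂ (φ j) u) → (∀ j p, AnalyticAt ℂ (pd (φ j) p) u) →
      eval (tval θ φ u) V = 0)
    (A B : Fin n → Fin n → MvPolynomial (Option (Fin n)) ℂ)
    (hBne : ∀ k p, ∃ u, (∀ j, AnalyticAt ℂ (φ j) u) ∧ (∀ j q, AnalyticAt ℂ (pd (φ j) q) u) ∧
      eval (tval θ φ u) (B k p) ≠ 0)
    (hAB : ∀ k p u, (∀ j, AnalyticAt ℂ (φ j) u) → (∀ j q, AnalyticAt ℂ (pd (φ j) q) u) →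
      eval (tval θ φ u) (B k p) ≠ 0 →
      pd (φ k) p u = eval (tval θ φ u) (A k p) / eval (tval θ φ u) (B k p))
    (P : Fin n → Fin n → MvPolynomial (Option (Fin n)) ℂ)
    (hP0 : ∀ k p, P k p ≠ 0)
    (hPid : ∀ k p (u : Fin n → ℂ), (∀ j, AnalyticAt ℂ (φ j) u) →
      (∀ j q, AnalyticAt ℂ (pd (φ j) q) u) →
      eval (fun i => i.elim (pd (φ k) p u) fun j => φ j u) (P k p) = 0)
    (b : Fin n → ℂ) (k : Fin n) (u₁ u₂ : Fin n → ℂ)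
    (h1 : ∀ j, AnalyticAt ℂ (φ j) u₁) (h1' : ∀ j p, AnalyticAt ℂ (pd (φ j) p) u₁)
    (h1θ : AnalyticAt ℂ θ u₁)
    (h2 : ∀ j, AnalyticAt ℂ (φ j) u₂) (h2' : ∀ j p, AnalyticAt ℂ (pd (φ j) p) u₂)
    (h2θ : AnalyticAt ℂ θ u₂)
    (h1b : AnalyticAt ℂ (φ k) (u₁ + b)) (h2b : AnalyticAt ℂ (φ k) (u₂ + b))
    (hφeq : ∀ j, φ j u₁ = φ j u₂) (hθeq : θ u₁ = θ u₂)
    (hBnz : ∀ j p, eval (tval θ φ u₁) (B j p) ≠ 0)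
    (hPz0 : ∀ j p, eval (fun i => i.elim (pd (φ j) p u₁) fun j' => φ j' u₁)
      (MvPolynomial.pderiv none (P j p)) ≠ 0) :
    φ k (u₁ + b) = φ k (u₂ + b) := by
  have hA2 : tval θ φ u₁ = tval θ φ u₂ := by
    funext i
    cases i with
    | none => exact hθeq
    | some j => exact hφeq j
  have hpd : ∀ j p, pd (φ j) p u₁ = pd (φ j) p u₂ := by
    intro j p
    rw [hAB j p u₁ h1 h1' (hBnz j p), hAB j p u₂ h2 h2' (hA2 ▸ hBnz j p), hA2]
  have htr : ∀ c : Fin n → ℂ, Tendsto (fun w : Fin n → ℂ => c + w) (𝓝 0) (𝓝 c) := by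
    intro c
    have : Continuous fun w : Fin n → ℂ => c + w := continuous_const.add continuous_id
    simpa using this.tendsto 0
  have hev : ∀ c : Fin n → ℂ, (∀ j, AnalyticAt ℂ (φ j) c) →
      (∀ j p, AnalyticAt ℂ (pd (φ j) p) c) → ∀ᶠ w in 𝓝 (0 : Fin n → ℂ),
      (∀ j, AnalyticAt ℂ (φ j) (c + w)) ∧ (∀ j p, AnalyticAt ℂ (pd (φ j) p) (c + w)) := by
    intro c hc hc'
    refine (htr c).eventually (p := fun y => (∀ j, AnalyticAt ℂ (φ j) y) ∧
      (∀ j p, AnalyticAt ℂ (pd (φ j) p) y)) ?_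
    exact (eventually_all.2 fun j => (hc j).eventually_analyticAt).and
      (eventually_all.2 fun j => eventually_all.2 fun p => (hc' j p).eventually_analyticAt)
  have he1 := hev u₁ h1 h1'
  have he2 := hev u₂ h2 h2'
  set D : (Fin n → ℂ) → (Fin n → ℂ) := fun w j => φ j (u₁ + w) - φ j (u₂ + w) with hDdef
  have hlip : ∀ j p, ∃ C : ℝ, 0 ≤ C ∧ ∀ᶠ w in 𝓝 (0 : Fin n → ℂ),
      ‖pd (φ j) p (u₁ + w) - pd (φ j) p (u₂ + w)‖ ≤ C * ‖D w‖ := by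
    intro j p
    obtain ⟨C, hC, hCe⟩ := aux_poly_lip (P j p) _ (hPz0 j p)
    refine ⟨C, hC, ?_⟩
    have hval : ∀ c : Fin n → ℂ, (∀ j, AnalyticAt ℂ (φ j) c) →
        (∀ j p, AnalyticAt ℂ (pd (φ j) p) c) →
        Tendsto (fun w : Fin n → ℂ => fun i : Option (Fin n) =>
          i.elim (pd (φ j) p (c + w)) fun j' => φ j' (c + w)) (𝓝 0)
          (𝓝 (fun i : Option (Fin n) => i.elim (pd (φ j) p c) fun j' => φ j' c)) := by
      intro c hc hc'
      rw [tendsto_pi_nhds]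
      rintro (_ | j')
      · exact (hc' j p).continuousAt.tendsto.comp (htr c)
      · exact (hc j').continuousAt.tendsto.comp (htr c)
    have hv1 := hval u₁ h1 h1'
    have hv2 := hval u₂ h2 h2'
    simp only [← hpd, ← hφeq] at hv2
    filter_upwards [(hv1.prodMk_nhds hv2).eventually hCe, he1, he2] with w hw hw1 hw2
    exact hw (hPid j p _ hw1.1 hw1.2) (hPid j p _ hw2.1 hw2.2)
  choose C hC hCe using hlip
  have hzero : ∀ᶠ w in 𝓝 (0 : Fin n → ℂ), D w = 0 := by
    refine aux_gronwall D (fun w => ContinuousLinearMap.pi fun j =>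
      fderiv ℂ (φ j) (u₁ + w) - fderiv ℂ (φ j) (u₂ + w)) (∑ j, ∑ p, C j p)
      (Finset.sum_nonneg fun j _ => Finset.sum_nonneg fun p _ => hC j p) ?_ ?_ ?_
    · filter_upwards [he1, he2] with w hw1 hw2
      rw [hasFDerivAt_pi]
      intro j
      exact ((hasFDerivAt_comp_add_left u₁).2 (hw1.1 j).differentiableAt.hasFDerivAt).sub
        ((hasFDerivAt_comp_add_left u₂).2 (hw2.1 j).differentiableAt.hasFDerivAt)
    · funext j
      simp [hDdef, hφeq]
    · filter_upwards [eventually_all.2 fun j => eventually_all.2 fun p => hCe j p] with w hw j p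
      refine (hw j p).trans (mul_le_mul_of_nonneg_right ?_ (norm_nonneg _))
      refine (Finset.single_le_sum (f := fun p => C j p) (fun p _ => hC j p)
        (Finset.mem_univ p)).trans ?_
      exact Finset.single_le_sum (f := fun j => ∑ p, C j p)
        (fun j _ => Finset.sum_nonneg fun p _ => hC j p) (Finset.mem_univ j)
  refine aux_mero_ident (hmero k) u₁ u₂ b ?_ h1b h2b
  filter_upwards [hzero] with w hw
  exact sub_eq_zero.1 (congrFun hw k)
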